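/- arXiv:1509.08175 — 4 statements merged into one kernel-verified Lean document; each statement's English description precedes it below -/
import Mathlib

section
/- Let μ* = −2√3/9 and suppose r : ℝ → ℝ is a function such that for every μ with μ* < μ < 2√3/9, r(μ) is the greatest real solution of μ + x − x³ = 0. Then (1 − 3·(r(μ))²)/√(μ − μ*) tends to −2·3^{1/4} as μ tends to μ* from the right; i.e., the linearized decay rate at the stable equilibrium vanishes like a square root of the parameter's distance to the bifurcation. -/
open Filter Topology

/-- Square-root scaling of the recovery rate near a saddle-node bifurcation
(Wissel's law): with `μ* = -2√3/9` and `r μ` the greatest real root of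
`μ + x - x³ = 0` on `(μ*, 2√3/9)`, the quantity `(1 - 3 (r μ)²)/√(μ - μ*)`
tends to `-2·3^(1/4)` as `μ → μ*⁺`. -/
theorem recovery_rate_square_root_scaling (r : ℝ → ℝ)
    (hr : ∀ μ : ℝ, μ ∈ Set.Ioo (-(2 * Real.sqrt 3 / 9)) (2 * Real.sqrt 3 / 9) →
      IsGreatest {x : ℝ | μ + x - x ^ 3 = 0} (r μ)) :
    Tendsto (fun μ : ℝ =>
        (1 - 3 * (r μ) ^ 2) / Real.sqrt (μ - (-(2 * Real.sqrt 3 / 9))))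
      (𝓝[>] (-(2 * Real.sqrt 3 / 9)))
      (𝓝 (-2 * (3 : ℝ) ^ ((1 : ℝ) / 4))) := by
  set s := Real.sqrt 3 with hs
  have hs2 : s ^ 2 = 3 := Real.sq_sqrt (by norm_num)
  have hs0 : 0 < s := Real.sqrt_pos.mpr (by norm_num)
  have hs3 : s ^ 3 = 3 * s := by rw [pow_succ, hs2]
  have hslt : s < 2 := by nlinarith
  have key : ∀ᶠ μ in 𝓝[>] (-(2 * s / 9)), μ ∈ Set.Ioo (-(2 * s / 9)) (2 * s / 9) :=
    Ioo_mem_nhdsGT (by linarith)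
  have hroot : ∀ μ ∈ Set.Ioo (-(2 * s / 9)) (2 * s / 9),
      s / 3 < r μ ∧ μ - (-(2 * s / 9)) = (r μ - s / 3) ^ 2 * (r μ - s / 3 + s) := by
    intro μ hμ
    obtain ⟨h1, h2⟩ := hr μ hμ
    obtain ⟨hm1, hm2⟩ := hμ
    have h1' : μ + r μ - r μ ^ 3 = 0 := h1
    constructor
    · have hc : ContinuousOn (fun x : ℝ => μ + x - x ^ 3) (Set.Icc (s / 3) 2) := by fun_prop
      have := intermediate_value_Ioo' (by linarith : s / 3 ≤ 2) hc
      have h0 : (0 : ℝ) ∈ Set.Ioo (μ + 2 - 2 ^ 3) (μ + s / 3 - (s / 3) ^ 3) := by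
        constructor
        · linarith
        · have : (s / 3) ^ 3 = s / 9 := by rw [div_pow, hs3]; ring
          linarith
      obtain ⟨x, hx, hx0⟩ := this h0
      exact lt_of_lt_of_le hx.1 (h2 hx0)
    · linear_combination h1' + (r μ / 3) * hs2 - (2 / 27) * hs3
  have hlim : Tendsto (fun μ => r μ - s / 3) (𝓝[>] (-(2 * s / 9))) (𝓝 0) := by
    have hu : Tendsto (fun μ : ℝ => Real.sqrt ((μ - (-(2 * s / 9))) / s))
        (𝓝[>] (-(2 * s / 9))) (𝓝 0) := by
      have hc : Continuous (fun μ : ℝ => Real.sqrt ((μ - (-(2 * s / 9))) / s)) := by fun_prop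
      have := (hc.tendsto (-(2 * s / 9))).mono_left
        (nhdsWithin_le_nhds (s := Set.Ioi (-(2 * s / 9))))
      simpa using this
    refine tendsto_of_tendsto_of_tendsto_of_le_of_le' tendsto_const_nhds hu ?_ ?_
    · filter_upwards [key] with μ hμ
      linarith [(hroot μ hμ).1]
    · filter_upwards [key] with μ hμ
      obtain ⟨h1, h2⟩ := hroot μ hμ
      apply Real.le_sqrt_of_sq_le
      rw [le_div_iff₀ hs0, h2]
      have : 0 < r μ - s / 3 := by linarith
      gcongr
      linarith
  have hmain : Tendsto (fun μ => -3 * ((r μ - s / 3) + 2 * s / 3) / Real.sqrt ((r μ - s / 3) + s))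
      (𝓝[>] (-(2 * s / 9))) (𝓝 (-3 * (0 + 2 * s / 3) / Real.sqrt (0 + s))) := by
    refine Tendsto.div ((hlim.add_const _).const_mul _) (hlim.add_const _).sqrt ?_
    rw [zero_add]
    exact (Real.sqrt_pos.mpr hs0).ne'
  have hval : -3 * (0 + 2 * s / 3) / Real.sqrt (0 + s) = -2 * (3 : ℝ) ^ ((1 : ℝ) / 4) := by
    have hq : (3 : ℝ) ^ ((1 : ℝ) / 4) = Real.sqrt s := by
      rw [hs, Real.sqrt_eq_rpow, Real.sqrt_eq_rpow, ← Real.rpow_mul (by norm_num)]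
      norm_num
    have h := Real.sqrt_pos.mpr hs0
    rw [hq, zero_add, zero_add, div_eq_iff h.ne', mul_assoc, Real.mul_self_sqrt hs0.le]
    ring
  rw [← hval]
  refine hmain.congr' ?_
  filter_upwards [key] with μ hμ
  obtain ⟨h1, h2⟩ := hroot μ hμ
  have hp : 0 < r μ - s / 3 := by linarith
  have hq : 0 < Real.sqrt (r μ - s / 3 + s) := Real.sqrt_pos.mpr (by linarith)
  rw [h2, Real.sqrt_mul (sq_nonneg _), Real.sqrt_sq hp.le, div_eq_div_iff hq.ne' (by positivity)]
  linear_combination (Real.sqrt (r μ - s / 3 + s)) * (1 / 3) * hs2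
end

section
/- Let f : ℝ → ℝ be continuous, let b < a < c with f(a) = 0, f(u) > 0 for all u ∈ (b, a), and f(u) < 0 for all u ∈ (a, c). If x : ℝ → ℝ is differentiable with x'(t) = f(x(t)) for all t ≥ 0 and x(0) ∈ (b, c), then x(t) ∈ (b, c) for all t ≥ 0 and x(t) converges to a as t → ∞. -/
open Filter Topology

theorem upper_trap (f x B : ℝ → ℝ) (m s : ℝ) (hs : 0 ≤ s)
    (hx : ∀ t : ℝ, 0 ≤ t → HasDerivAt x (f (x t)) t)
    (hB : ∀ t, HasDerivAt B m t)
    (h0 : x s ≤ B s) (h : ∀ t, s ≤ t → x t = B t → f (x t) < m) :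
    ∀ t, s ≤ t → x t ≤ B t := by
  intro t ht
  exact image_le_of_deriv_right_lt_deriv_boundary (f := x) (f' := fun t => f (x t))
    (a := s) (b := t) (B := B) (B' := fun _ => m)
    (fun u hu => (hx u (hs.trans hu.1)).continuousAt.continuousWithinAt)
    (fun u hu => (hx u (hs.trans hu.1)).hasDerivWithinAt) h0 hB
    (fun u hu hh => h u hu.1 hh) ⟨ht, le_rfl⟩

theorem upper_half (f : ℝ → ℝ) (hf : Continuous f)
    (a c : ℝ) (hac : a < c)
    (hright : ∀ u ∈ Set.Ioo a c, f u < 0)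
    (x : ℝ → ℝ) (hx : ∀ t : ℝ, 0 ≤ t → HasDerivAt x (f (x t)) t)
    (hx0 : x 0 < c) :
    (∀ t : ℝ, 0 ≤ t → x t < c) ∧ ∀ d, a < d → ∀ᶠ t in atTop, x t < d := by
  have trap : ∀ M, a < M → M < c → ∀ s, 0 ≤ s → x s ≤ M → ∀ t, s ≤ t → x t ≤ M := by
    intro M h1 h2 s hs h0
    refine upper_trap f x (fun _ => M) 0 s hs hx (fun t => hasDerivAt_const t M) h0 ?_
    intro t _ h
    rw [h]
    exact hright M ⟨h1, h2⟩
  obtain ⟨e, he1, he2⟩ := exists_between (max_lt hac hx0)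
  have hae : a < e := (le_max_left _ _).trans_lt he1
  have hxe : x 0 < e := (le_max_right _ _).trans_lt he1
  refine ⟨fun t ht => (trap e hae he2 0 le_rfl hxe.le t ht).trans_lt he2, ?_⟩
  intro d hd
  obtain ⟨k, hk1, hk2⟩ := exists_between (lt_min hd hae)
  have hkd : k < d := hk2.trans_le (min_le_left _ _)
  have hke : k < e := hk2.trans_le (min_le_right _ _)
  have reach : ∃ T, 0 ≤ T ∧ x T ≤ k := by
    by_contra! hno
    obtain ⟨w, hw, hmax⟩ := (isCompact_Icc (a := k) (b := e)).exists_isMaxOn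
      ⟨k, le_rfl, hke.le⟩ hf.continuousOn
    have hfw : f w < 0 := hright w ⟨hk1.trans_le hw.1, hw.2.trans_lt he2⟩
    have key := upper_trap f x (fun t => x 0 + f w / 2 * t) (f w / 2) 0 le_rfl hx
      (fun t => by simpa using ((hasDerivAt_id t).const_mul (f w / 2)).const_add (x 0))
      (by simp) (by
        intro t ht _
        have h1 : f (x t) ≤ f w :=
          hmax ⟨(hno t ht).le, trap e hae he2 0 le_rfl hxe.le t ht⟩
        linarith)
    have hT : 0 ≤ (x 0 - k) / (-(f w / 2)) :=
      div_nonneg (by linarith [hno 0 le_rfl]) (by linarith)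
    have h1 := key _ hT
    have h2 := hno _ hT
    have h3 : f w / 2 * ((x 0 - k) / (-(f w / 2))) = -(x 0 - k) := by
      have hne : f w ≠ 0 := hfw.ne
      field_simp
    simp only [h3] at h1
    linarith
  obtain ⟨T, hT, hxT⟩ := reach
  filter_upwards [eventually_ge_atTop T] with t ht
  exact (trap k hk1 (hke.trans he2) T hT hxT t ht).trans_lt hkd

/-- Basin of attraction: if `b < a < c`, `f(a) = 0`, `f > 0` on `(b, a)` and
`f < 0` on `(a, c)`, then a solution of `x' = f(x)` starting in `(b, c)` stays
in `(b, c)` for all `t ≥ 0` and converges to the stable equilibrium `a`. -/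
theorem basin_of_attraction_convergence (f : ℝ → ℝ) (hf : Continuous f)
    (a b c : ℝ) (hba : b < a) (hac : a < c) (ha : f a = 0)
    (hleft : ∀ u ∈ Set.Ioo b a, 0 < f u)
    (hright : ∀ u ∈ Set.Ioo a c, f u < 0)
    (x : ℝ → ℝ) (hx : ∀ t : ℝ, 0 ≤ t → HasDerivAt x (f (x t)) t)
    (hx0 : x 0 ∈ Set.Ioo b c) :
    (∀ t : ℝ, 0 ≤ t → x t ∈ Set.Ioo b c) ∧ Tendsto x atTop (𝓝 a) := by
  obtain ⟨u1, u2⟩ := upper_half f hf a c hac hright x hx hx0.2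
  obtain ⟨l1, l2⟩ := upper_half (fun u => -f (-u)) (by fun_prop) (-a) (-b) (by linarith)
    (fun u hu => by
      have := hleft (-u) ⟨by linarith [hu.2], by linarith [hu.1]⟩
      simpa using this)
    (fun t => -x t) (fun t ht => by simpa using (hx t ht).fun_neg) (by simpa using hx0.1)
  refine ⟨fun t ht => ⟨by linarith [l1 t ht], u1 t ht⟩, ?_⟩
  rw [tendsto_order]
  refine ⟨fun d hd => ?_, u2⟩
  filter_upwards [l2 (-d) (by linarith)] with t ht
  linarith
end

section
/- Let f : ℝ → ℝ be continuous, let c > 0, h > 0, q ∈ ℝ, and suppose f(u) ≤ −c for all u ∈ [q − h, q]. Let τ ≥ h/c and let y : [0, τ] → ℝ be differentiable with y'(t) = f(y(t)) for all t ∈ [0, τ]. If y(0) ≤ q, then y(t) ≤ q for all t ∈ [0, τ], and y(τ) ≤ q − h. -/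
/-- Recovery in a steep basin section: if `f ≤ -c` on `[q - h, q]` and
`τ ≥ h / c`, then a solution `y` of `y' = f(y)` on `[0, τ]` with `y(0) ≤ q`
satisfies `y(t) ≤ q` throughout and has recovered by at least `h` at time `τ`:
`y(τ) ≤ q - h`. -/
theorem steep_section_recovery (f : ℝ → ℝ) (hf : Continuous f)
    (c h q : ℝ) (hc : 0 < c) (hh : 0 < h)
    (hsteep : ∀ u ∈ Set.Icc (q - h) q, f u ≤ -c)
    (τ : ℝ) (hτ : h / c ≤ τ)
    (y : ℝ → ℝ) (hy : ∀ t ∈ Set.Icc (0 : ℝ) τ, HasDerivAt y (f (y t)) t)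
    (hy0 : y 0 ≤ q) :
    (∀ t ∈ Set.Icc (0 : ℝ) τ, y t ≤ q) ∧ y τ ≤ q - h := by
  have hτ0 : 0 < τ := lt_of_lt_of_le (div_pos hh hc) hτ
  have hcτ : h ≤ τ * c := (div_le_iff₀ hc).1 hτ
  have key : ∀ k : ℝ, 0 ≤ k → k * τ < h → ∀ t ∈ Set.Icc (0 : ℝ) τ, y t ≤ q - k * t := by
    intro k hk hkτ t ht
    refine image_le_of_deriv_right_lt_deriv_boundary (f := y) (f' := fun t => f (y t))
      (B := fun t => q - k * t) (B' := fun _ => -k) (a := 0) (b := τ)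
      (fun x hx => (hy x hx).continuousAt.continuousWithinAt)
      (fun x hx => (hy x ⟨hx.1, hx.2.le⟩).hasDerivWithinAt) (by simpa using hy0) ?_ ?_ ht
    · intro x
      simpa using ((hasDerivAt_id x).const_mul k).const_sub q
    · intro x hx hxe
      have hkc : k < c := by
        by_contra hcon
        nlinarith [not_lt.1 hcon]
      have h1 : k * x ≤ k * τ := mul_le_mul_of_nonneg_left hx.2.le hk
      have h2 : 0 ≤ k * x := mul_nonneg hk hx.1
      have hxe' : y x = q - k * x := hxe
      have h3 := hsteep (y x) ⟨by linarith, by linarith⟩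
      show f (y x) < -k
      linarith
  refine ⟨fun t ht => by simpa using key 0 le_rfl (by simpa using hh) t ht, ?_⟩
  by_contra hcon
  have hs : q - y τ < h := by linarith [not_le.1 hcon]
  have hm : max 0 (q - y τ) < h := max_lt hh hs
  have hm0 := le_max_left 0 (q - y τ)
  have hm1 := le_max_right 0 (q - y τ)
  have hk : (max 0 (q - y τ) + h) / 2 / τ * τ = (max 0 (q - y τ) + h) / 2 :=
    div_mul_cancel₀ _ hτ0.ne'
  have := key ((max 0 (q - y τ) + h) / 2 / τ) (by positivity) (by rw [hk]; linarith) τ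
    ⟨hτ0.le, le_rfl⟩
  rw [hk] at this
  linarith
end

section
/- Let f : ℝ → ℝ be continuous, c > 0, h > 0, q ∈ ℝ with f(u) ≤ −c for all u ∈ [q − h, q], and let τ ≥ h/c. Suppose x : ℕ → ℝ models a system subject to repeated rightward perturbations of size h: for each n there is a differentiable function yₙ : [0, τ] → ℝ with yₙ'(t) = f(yₙ(t)) for all t ∈ [0, τ], yₙ(0) = xₙ + h, and xₙ₊₁ = yₙ(τ). If x₀ ≤ q − h, then xₙ ≤ q − h for all n; in particular the perturbed state xₙ + h never exceeds q, so the system never crosses the threshold at q. -/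
/-- Resilience to repeated perturbations: suppose `f ≤ -c` on the steep section
`[q - h, q]` and `τ ≥ h / c`. If the state `x : ℕ → ℝ` is perturbed rightward by
`h` at each step and then flows under `x' = f(x)` for time `τ` (i.e. there is a
solution `y` on `[0, τ]` with `y 0 = xₙ + h` and `xₙ₊₁ = y τ`), and `x₀ ≤ q - h`,
then `xₙ ≤ q - h` for all `n`, so the perturbed state `xₙ + h` never exceeds the
threshold `q`. -/
theorem repeated_perturbations_never_cross_threshold (f : ℝ → ℝ) (hf : Continuous f)
    (c h q : ℝ) (hc : 0 < c) (hh : 0 < h)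
    (hsteep : ∀ u ∈ Set.Icc (q - h) q, f u ≤ -c)
    (τ : ℝ) (hτ : h / c ≤ τ)
    (x : ℕ → ℝ)
    (hstep : ∀ n : ℕ, ∃ y : ℝ → ℝ,
      (∀ t ∈ Set.Icc (0 : ℝ) τ, HasDerivAt y (f (y t)) t) ∧
      y 0 = x n + h ∧ x (n + 1) = y τ)
    (hx0 : x 0 ≤ q - h) :
    (∀ n : ℕ, x n ≤ q - h) ∧ ∀ n : ℕ, x n + h ≤ q := by
  have hτ0 : 0 < τ := lt_of_lt_of_le (div_pos hh hc) hτ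
  have hcτ : h ≤ c * τ := by
    rw [div_le_iff₀ hc] at hτ
    linarith
  have main : ∀ n : ℕ, x n ≤ q - h := by
    intro n
    induction n with
    | zero => exact hx0
    | succ n ih =>
      obtain ⟨y, hy, hy0, hyτ⟩ := hstep n
      have key : ∀ k : ℝ, 0 ≤ k → k * τ < h → y τ ≤ q - k * τ := by
        intro k hk hkτ
        have hkc : k < c := by
          by_contra hcon
          have := mul_le_mul_of_nonneg_right (not_lt.mp hcon) hτ0.le
          linarith
        have hB : ∀ t : ℝ, HasDerivAt (fun s : ℝ => q - k * s) (-k) t := by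
          intro t
          simpa using ((hasDerivAt_id t).const_mul k).const_sub q
        refine image_le_of_deriv_right_lt_deriv_boundary (f := y) (f' := fun t => f (y t))
          (a := 0) (b := τ) (B := fun s : ℝ => q - k * s) (B' := fun _ => -k)
          (fun t ht => (hy t ht).continuousAt.continuousWithinAt)
          (fun t ht => (hy t ⟨ht.1, ht.2.le⟩).hasDerivWithinAt)
          (by simp only [mul_zero]; linarith) hB ?_ ⟨hτ0.le, le_rfl⟩
        intro t ht hyt
        have h1 : 0 ≤ k * t := mul_nonneg hk ht.1
        have h2 : k * t ≤ k * τ := mul_le_mul_of_nonneg_left ht.2.le hk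
        have h3 := hsteep (y t) ⟨by simp only [hyt]; linarith, by simp only [hyt]; linarith⟩
        show f (y t) < -k
        linarith
      rw [hyτ]
      by_contra hcon
      rw [not_le] at hcon
      have h0 := key 0 le_rfl (by simpa using hh)
      have e : ((q - y τ + h) / 2 / τ) * τ = (q - y τ + h) / 2 := div_mul_cancel₀ _ hτ0.ne'
      have h1 := key ((q - y τ + h) / 2 / τ) (div_nonneg (by linarith) hτ0.le)
        (by rw [e]; linarith)
      rw [e] at h1
      linarith
  exact ⟨main, fun n => by linarith [main n]⟩
end
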